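/- Let p ≥ 3 be an integer, C₁ > 0, and let v be a simple L-periodic arc-length curve of class C³. Suppose given an integer N₀ ≥ 1 and, for each j ≥ 0, a strictly increasing sequence s^j : ℤ → ℝ with s^j_{i+N₀·2^j} = s^j_i + L for all i, and for each j ≥ 1 sequences d^j : ℤ → ℝ and ξ^j : ℤ → ℝ such that for every j ≥ 1, every i ∈ ℤ and every K ∈ ℤ with 2i ≤ K ≤ 2i + p + 2: (a) v(s^j_K) = (S_p(v∘s^{j−1}))_K + d^j_K·n(ξ^j_K); (b) |ξ^j_K − s^{j−1}_k| ≤ C₁·h^{j−1}_i for every k with i ≤ k ≤ i + p + 1; (c) |s^j_K − ξ^j_K| ≤ C₁·h^{j−1}_i, where h^{j−1}_i := max_{i ≤ l ≤ i+p} (s^{j−1}_{l+1} − s^{j−1}_l). If the continuous piecewise-linear interpolants s^j(t), determined by s^j(2^{−j}i) = s^j_i, converge as j → ∞ uniformly on compact subsets of ℝ to a function s : ℝ → ℝ, then s is twice continuously differentiable and, for every α ∈ (0,1), its second derivative s'' is α-Hölder continuous on every compact interval (i.e. the normal re-parametrization is C^{2,1−}). -/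

import Mathlib

/-- The Lane–Riesenfeld (B-spline) subdivision operator `S p`, acting on sequences with
values in a real vector space (componentwise averaging). -/
noncomputable def S {E : Type*} [AddCommGroup E] [Module ℝ E] : ℕ → (ℤ → E) → ℤ → E
  | 0, x, i => x (Int.fdiv i 2)
  | p + 1, x, i => (2⁻¹ : ℝ) • (S p x i + S p x (i + 1))

/-- Euclidean scalar product on `ℝ²`. -/
noncomputable def dot (u w : ℝ × ℝ) : ℝ := u.1 * w.1 + u.2 * w.2

/-- Rotation by 90°: `u^⊥ = (−u₂, u₁)`. -/
def perp (u : ℝ × ℝ) : ℝ × ℝ := (-u.2, u.1)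

/-- Local mesh size `h_i = max_{i ≤ l ≤ i+p} (x_{l+1} − x_l)`. -/
noncomputable def hmax (p : ℕ) (x : ℤ → ℝ) (i : ℤ) : ℝ :=
  (Finset.Icc i (i + p)).sup' (Finset.nonempty_Icc.mpr (by omega)) (fun l => x (l + 1) - x l)

/-- The continuous piecewise-linear interpolant of the data `x : ℤ → ℝ` on the grid
`2^{−j}ℤ`, i.e. the function with `plin j x (2^{−j} i) = x i`, linear in between. -/
noncomputable def plin (j : ℕ) (x : ℤ → ℝ) (t : ℝ) : ℝ :=
  x ⌊(2 : ℝ) ^ j * t⌋ +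
    ((2 : ℝ) ^ j * t - (⌊(2 : ℝ) ^ j * t⌋ : ℤ)) * (x (⌊(2 : ℝ) ^ j * t⌋ + 1) - x ⌊(2 : ℝ) ^ j * t⌋)

theorem S_add {p : ℕ} (x y : ℤ → ℝ) (i : ℤ) :
    S p (fun k => x k + y k) i = S p x i + S p y i := by
  induction p generalizing i with
  | zero => simp [S]
  | succ p ih => simp only [S, ih, smul_eq_mul]; ring

theorem S_const {p : ℕ} (c : ℝ) (i : ℤ) : S p (fun _ => c) i = c := by
  induction p generalizing i with
  | zero => simp [S]
  | succ p ih => simp only [S, ih, smul_eq_mul]; ring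

theorem S_const_mul {p : ℕ} (c : ℝ) (x : ℤ → ℝ) (i : ℤ) :
    S p (fun k => c * x k) i = c * S p x i := by
  induction p generalizing i with
  | zero => simp [S]
  | succ p ih => simp only [S, ih, smul_eq_mul]; ring

theorem dot_S {p : ℕ} (x : ℤ → ℝ × ℝ) (w : ℝ × ℝ) (i : ℤ) :
    dot (S p x i) w = S p (fun k => dot (x k) w) i := by
  induction p generalizing i with
  | zero => simp [S]
  | succ p ih =>
    simp only [S, ← ih, smul_eq_mul]
    simp only [dot, Prod.smul_fst, Prod.smul_snd, Prod.fst_add, Prod.snd_add, smul_eq_mul]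
    ring

/-- `(S p x)_i` depends only on the entries `x_k` with `⌊i/2⌋ ≤ k ≤ ⌊i/2⌋ + p`. -/
theorem abs_S_le_of_local {p : ℕ} {x : ℤ → ℝ} {i : ℤ} {M : ℝ}
    (h : ∀ k, i / 2 ≤ k → k ≤ i / 2 + p → |x k| ≤ M) : |S p x i| ≤ M := by
  induction p generalizing i with
  | zero =>
    simp only [S, Int.fdiv_eq_ediv_of_nonneg _ (zero_le_two : (0 : ℤ) ≤ 2)]
    exact h _ le_rfl (by simp)
  | succ p ih =>
    have h1 := ih (i := i) fun k hk hk' => h k hk (by push_cast; omega)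
    have h2 := ih (i := i + 1) fun k hk hk' => h k (by omega) (by push_cast; omega)
    rw [abs_le] at *
    simp only [S, smul_eq_mul]
    constructor <;> linarith [h1.1, h1.2, h2.1, h2.2]

theorem abs_S_le {p : ℕ} {x : ℤ → ℝ} {M : ℝ} (h : ∀ k, |x k| ≤ M) (i : ℤ) : |S p x i| ≤ M :=
  abs_S_le_of_local fun k _ _ => h k

theorem fwdDiff_S {p : ℕ} (x : ℤ → ℝ) (i : ℤ) :
    S (p + 1) x (i + 1) - S (p + 1) x i = 2⁻¹ * S p (fwdDiff 1 x) i := by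
  induction p generalizing i with
  | zero =>
    simp only [S, smul_eq_mul, fwdDiff, Int.fdiv_eq_ediv_of_nonneg _ (zero_le_two : (0 : ℤ) ≤ 2)]
    rw [show (i + 1 + 1) / 2 = i / 2 + 1 by omega]
    ring
  | succ p ih =>
    have h1 := ih i
    have h2 := ih (i + 1)
    have e1 : S (p + 2) x (i + 1) = 2⁻¹ * (S (p + 1) x (i + 1) + S (p + 1) x (i + 1 + 1)) := rfl
    have e2 : S (p + 2) x i = 2⁻¹ * (S (p + 1) x i + S (p + 1) x (i + 1)) := rfl
    have e3 : S (p + 1) (fwdDiff 1 x) i =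
      2⁻¹ * (S p (fwdDiff 1 x) i + S p (fwdDiff 1 x) (i + 1)) := rfl
    rw [e1, e2, e3]
    linarith

/-- A perturbed subdivision step passes to forward differences. -/
theorem abs_fwdDiff_sub_S_le {p : ℕ} {x y : ℤ → ℝ} {ε : ℝ}
    (h : ∀ i, |y i - S (p + 1) x i| ≤ ε) (i : ℤ) :
    |fwdDiff 1 y i - 2⁻¹ * S p (fwdDiff 1 x) i| ≤ 2 * ε := by
  have h1 := h i
  have h2 := h (i + 1)
  rw [← fwdDiff_S, fwdDiff]
  rw [abs_le] at *
  constructor <;> linarith [h1.1, h1.2, h2.1, h2.2]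

theorem abs_S_sub_le {p : ℕ} {x : ℤ → ℝ} {M : ℝ} (h : ∀ k, |fwdDiff 1 x k| ≤ M) (i : ℤ) :
    |S p x i - x (i / 2)| ≤ p * M := by
  induction p generalizing i with
  | zero => simp [S, Int.fdiv_eq_ediv_of_nonneg _ (zero_le_two : (0 : ℤ) ≤ 2)]
  | succ p ih =>
    have h1 := ih i
    have h2 := ih (i + 1)
    have h3 : |x ((i + 1) / 2) - x (i / 2)| ≤ M := by
      have h0 : 0 ≤ M := (abs_nonneg _).trans (h 0)
      rcases (by omega : (i + 1) / 2 = i / 2 ∨ (i + 1) / 2 = i / 2 + 1) with e | e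
      · simpa [e]
      · rw [e]; exact h _
    have h0 : 0 ≤ M := (abs_nonneg _).trans (h 0)
    simp only [S, smul_eq_mul]
    push_cast
    rw [abs_le] at *
    constructor <;> linarith [h1.1, h1.2, h2.1, h2.2, h3.1, h3.2]

/-- Third-order tangential Taylor expansion of a closed arc-length curve, with a uniform
constant. -/
theorem exists_tangential_taylor_bound {L : ℝ} (hL : 0 < L) {v : ℝ → ℝ × ℝ}
    (hper : ∀ t, v (t + L) = v t) (hreg : ContDiff ℝ 2 v)
    (hunit : ∀ t, dot (deriv v t) (deriv v t) = 1) :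
    ∃ B : ℝ, 0 ≤ B ∧ ∀ t ξ, |dot (v t) (deriv v ξ) - dot (v ξ) (deriv v ξ) - (t - ξ)| ≤
      B * |t - ξ| ^ 3 := by
  have hd : Differentiable ℝ v := hreg.differentiable (by norm_num)
  have hreg' : ContDiff ℝ 1 (deriv v) := by
    have := (contDiff_succ_iff_deriv (n := 1) (f := v) (𝕜 := ℝ)).1 (by simpa [one_add_one_eq_two] using hreg)
    exact this.2.2
  have hd' : Differentiable ℝ (deriv v) := hreg'.differentiable (by norm_num)
  have hc : Continuous (deriv (deriv v)) := hreg'.continuous_deriv le_rfl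
  have hp1 : Function.Periodic (deriv v) L := fun t => by
    rw [← deriv_comp_add_const]; congr 1; exact funext hper
  have hp2 : Function.Periodic (deriv (deriv v)) L := fun t => by
    rw [← deriv_comp_add_const]; congr 1; exact funext hp1
  obtain ⟨M, hM⟩ := (hp2.isBounded_of_continuous hL.ne' hc).exists_norm_le
  have hM : ∀ t, ‖deriv (deriv v) t‖ ≤ M := fun t => hM _ ⟨t, rfl⟩
  have hlip : ∀ t ξ, ‖deriv v t - deriv v ξ‖ ≤ M * |t - ξ| := fun t ξ =>
    convex_univ.norm_image_sub_le_of_norm_deriv_le (fun x _ => hd' x) (fun x _ => hM x)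
      trivial trivial
  have hdot : ∀ t ξ, |dot (deriv v t) (deriv v ξ) - 1| ≤ M ^ 2 * |t - ξ| ^ 2 := by
    intro t ξ
    have h1 : |(deriv v t).1 - (deriv v ξ).1| ≤ M * |t - ξ| :=
      (norm_fst_le (deriv v t - deriv v ξ)).trans (hlip t ξ)
    have h2 : |(deriv v t).2 - (deriv v ξ).2| ≤ M * |t - ξ| :=
      (norm_snd_le (deriv v t - deriv v ξ)).trans (hlip t ξ)
    have h1' := pow_le_pow_left₀ (abs_nonneg _) h1 2
    have h2' := pow_le_pow_left₀ (abs_nonneg _) h2 2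
    have u1 := hunit t
    have u2 := hunit ξ
    simp only [dot] at *
    rw [sq_abs] at h1' h2'
    rw [mul_pow] at h1' h2'
    rw [abs_le]
    constructor <;> nlinarith [sq_nonneg ((deriv v t).1 - (deriv v ξ).1),
      sq_nonneg ((deriv v t).2 - (deriv v ξ).2)]
  refine ⟨M ^ 2, sq_nonneg _, fun t ξ => ?_⟩
  have hF : ∀ x, HasDerivAt (fun x => dot (v x) (deriv v ξ) - dot (v ξ) (deriv v ξ) - (x - ξ))
      (dot (deriv v x) (deriv v ξ) - 1) x := by
    intro x
    have hx := (hd x).hasDerivAt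
    have h1 : HasDerivAt (fun x => (v x).1) (deriv v x).1 x :=
      (ContinuousLinearMap.fst ℝ ℝ ℝ).hasFDerivAt.comp_hasDerivAt x hx
    have h2 : HasDerivAt (fun x => (v x).2) (deriv v x).2 x :=
      (ContinuousLinearMap.snd ℝ ℝ ℝ).hasFDerivAt.comp_hasDerivAt x hx
    exact (((h1.mul_const _).add (h2.mul_const _)).sub_const _).sub ((hasDerivAt_id x).sub_const ξ)
  have := (convex_uIcc ξ t).norm_image_sub_le_of_norm_hasDerivWithin_le
    (C := M ^ 2 * |t - ξ| ^ 2) (fun x _ => (hF x).hasDerivWithinAt) (fun x hx => by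
      refine (hdot x ξ).trans ?_
      exact mul_le_mul_of_nonneg_left
        (pow_le_pow_left₀ (abs_nonneg _) (Set.abs_sub_left_of_mem_uIcc hx) 2) (sq_nonneg M))
    Set.left_mem_uIcc Set.right_mem_uIcc
  simp only [sub_self, sub_zero, Real.norm_eq_abs] at this
  calc _ ≤ _ := this
    _ = _ := by ring

open Filter Topology in
/-- A nonnegative null sequence halving up to a cubic error decays like `2^{-j}`. -/
theorem exists_le_half_pow_of_cubic_recursion {δ : ℕ → ℝ} {A : ℝ} (hA : 0 ≤ A)
    (h0 : ∀ j, 0 ≤ δ j) (hrec : ∀ j, δ (j + 1) ≤ δ j / 2 + A * δ j ^ 3)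
    (hlim : Tendsto δ atTop (𝓝 0)) : ∃ C, ∀ j, δ j ≤ C * (1 / 2) ^ j := by
  have hev : ∀ᶠ j in atTop, A * δ j ^ 2 < 1 / 4 := by
    have : Tendsto (fun j => A * δ j ^ 2) atTop (𝓝 (A * 0 ^ 2)) := (hlim.pow 2).const_mul A
    exact this.eventually_lt_const (by norm_num)
  obtain ⟨J, hJ⟩ := eventually_atTop.1 hev
  have key : ∀ j ≥ J, δ j * 2 ^ j * Real.exp (5 * A * δ j ^ 2) ≤
      δ J * 2 ^ J * Real.exp (5 * A * δ J ^ 2) := by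
    intro j hj
    induction j, hj using Nat.le_induction with
    | base => exact le_rfl
    | succ j hj ih =>
      refine le_trans ?_ ih
      have hj' := hJ j hj
      have hd := h0 j
      have h1 : δ (j + 1) ≤ 3 / 4 * δ j := by nlinarith [hrec j]
      have h2 : δ (j + 1) ^ 2 ≤ 9 / 16 * δ j ^ 2 := by
        have := pow_le_pow_left₀ (h0 (j + 1)) h1 2
        linarith [this, mul_pow (3 / 4 : ℝ) (δ j) 2]
      have h3 : δ (j + 1) * 2 ≤ δ j * Real.exp (2 * A * δ j ^ 2) := by
        have := Real.add_one_le_exp (2 * A * δ j ^ 2)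
        nlinarith [hrec j, mul_le_mul_of_nonneg_left this hd]
      have h4 : Real.exp (5 * A * δ (j + 1) ^ 2) ≤ Real.exp (3 * A * δ j ^ 2) := by
        apply Real.exp_le_exp.2
        nlinarith [mul_le_mul_of_nonneg_left h2 hA, mul_nonneg hA (sq_nonneg (δ j))]
      calc δ (j + 1) * 2 ^ (j + 1) * Real.exp (5 * A * δ (j + 1) ^ 2)
          = 2 ^ j * ((δ (j + 1) * 2) * Real.exp (5 * A * δ (j + 1) ^ 2)) := by ring
        _ ≤ 2 ^ j * ((δ j * Real.exp (2 * A * δ j ^ 2)) * Real.exp (3 * A * δ j ^ 2)) := by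
            gcongr
        _ = δ j * 2 ^ j * (Real.exp (2 * A * δ j ^ 2) * Real.exp (3 * A * δ j ^ 2)) := by ring
        _ = δ j * 2 ^ j * Real.exp (5 * A * δ j ^ 2) := by rw [← Real.exp_add]; ring_nf
  have hbdd : IsBoundedUnder (· ≤ ·) atTop fun j => δ j * 2 ^ j := by
    refine ⟨δ J * 2 ^ J * Real.exp (5 * A * δ J ^ 2), eventually_map.2 ?_⟩
    filter_upwards [eventually_ge_atTop J] with j hj
    refine le_trans ?_ (key j hj)
    have := Real.one_le_exp (mul_nonneg (mul_nonneg (by norm_num : (0 : ℝ) ≤ 5) hA)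
      (sq_nonneg (δ j)))
    exact le_mul_of_one_le_right (mul_nonneg (h0 j) (by positivity)) this
  obtain ⟨C, hC⟩ := hbdd.bddAbove_range
  refine ⟨C, fun j => ?_⟩
  have := hC ⟨j, rfl⟩
  rw [one_div, inv_pow, ← div_eq_mul_inv, le_div_iff₀ (by positivity)]
  exact this

theorem floor_two_pow_succ_mul_ediv (j : ℕ) (t : ℝ) :
    ⌊(2 : ℝ) ^ (j + 1) * t⌋ / 2 = ⌊(2 : ℝ) ^ j * t⌋ := by
  have := Int.floor_div_natCast ((2 : ℝ) ^ (j + 1) * t) 2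
  push_cast at this
  rw [← this]
  congr 1
  ring

open Filter Topology in
theorem tendsto_floor_div_two_pow (t : ℝ) :
    Tendsto (fun j : ℕ => (⌊(2 : ℝ) ^ j * t⌋ : ℝ) * (1 / 2) ^ j) atTop (𝓝 t) := by
  have h : Tendsto (fun j : ℕ => t - (1 / 2 : ℝ) ^ j) atTop (𝓝 (t - 0)) :=
    (tendsto_pow_atTop_nhds_zero_of_lt_one (by norm_num) (by norm_num)).const_sub t
  rw [sub_zero] at h
  have e : ∀ j : ℕ, (2 : ℝ) ^ j * (1 / 2) ^ j = 1 := fun j => by rw [← mul_pow]; norm_num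
  refine tendsto_of_tendsto_of_tendsto_of_le_of_le h tendsto_const_nhds (fun j => ?_) fun j => ?_
  · have := mul_le_mul_of_nonneg_right (Int.sub_one_lt_floor ((2 : ℝ) ^ j * t)).le
      (by positivity : (0 : ℝ) ≤ (1 / 2) ^ j)
    linear_combination this - t * e j
  · have := mul_le_mul_of_nonneg_right (Int.floor_le ((2 : ℝ) ^ j * t))
      (by positivity : (0 : ℝ) ≤ (1 / 2) ^ j)
    linear_combination this + t * e j

section StepLimit

open Filter Topology

variable {x : ℕ → ℤ → ℝ} {f : ℝ → ℝ} {C r M : ℝ}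

theorem dist_step_le (h : ∀ j K, |x (j + 1) K - x j (K / 2)| ≤ C * r ^ j) (t : ℝ) (j : ℕ) :
    dist (x j ⌊(2 : ℝ) ^ j * t⌋) (x (j + 1) ⌊(2 : ℝ) ^ (j + 1) * t⌋) ≤ C * r ^ j := by
  rw [dist_comm, Real.dist_eq, ← floor_two_pow_succ_mul_ediv j t]
  exact h _ _

theorem exists_tendsto_step (hr : r < 1)
    (h : ∀ j K, |x (j + 1) K - x j (K / 2)| ≤ C * r ^ j) :
    ∃ f : ℝ → ℝ, ∀ t, Tendsto (fun j : ℕ => x j ⌊(2 : ℝ) ^ j * t⌋) atTop (𝓝 (f t)) := by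
  have := fun t => cauchySeq_tendsto_of_complete
    (cauchySeq_of_le_geometric r C hr (dist_step_le h t))
  exact ⟨fun t => (this t).choose, fun t => (this t).choose_spec⟩

theorem abs_step_sub_le (hr : r < 1) (h : ∀ j K, |x (j + 1) K - x j (K / 2)| ≤ C * r ^ j)
    (hf : ∀ t, Tendsto (fun j : ℕ => x j ⌊(2 : ℝ) ^ j * t⌋) atTop (𝓝 (f t))) (j : ℕ) (t : ℝ) :
    |x j ⌊(2 : ℝ) ^ j * t⌋ - f t| ≤ C / (1 - r) * r ^ j := by
  have := dist_le_of_le_geometric_of_tendsto r C hr (dist_step_le h t) (hf t) j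
  rw [Real.dist_eq] at this
  convert this using 1
  ring

theorem abs_step_limit_le (hr : r < 1) (h : ∀ j K, |x (j + 1) K - x j (K / 2)| ≤ C * r ^ j)
    (hf : ∀ t, Tendsto (fun j : ℕ => x j ⌊(2 : ℝ) ^ j * t⌋) atTop (𝓝 (f t)))
    (h0 : ∀ k, |x 0 k| ≤ M) (t : ℝ) : |f t| ≤ M + C / (1 - r) := by
  have h1 := abs_step_sub_le hr h hf 0 t
  have h2 := h0 ⌊t⌋
  simp only [pow_zero, one_mul, mul_one] at h1
  rw [abs_le] at *
  constructor <;> linarith [h1.1, h1.2, h2.1, h2.2]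

theorem exists_step_bound (hr0 : 0 ≤ r) (hr : r < 1)
    (h : ∀ j K, |x (j + 1) K - x j (K / 2)| ≤ C * r ^ j)
    (h0 : ∀ k, |x 0 k| ≤ M) : ∃ B, ∀ j k, |x j k| ≤ B := by
  obtain ⟨f, hf⟩ := exists_tendsto_step hr h
  refine ⟨M + C / (1 - r) + C / (1 - r), fun j k => ?_⟩
  have hC : 0 ≤ C := by simpa using (abs_nonneg _).trans (h 0 0)
  have e : (2 : ℝ) ^ j * (k * (1 / 2) ^ j) = k := by
    rw [mul_left_comm, ← mul_pow]; norm_num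
  have h1 := abs_step_sub_le hr h hf j (k * (1 / 2) ^ j)
  rw [e, Int.floor_intCast] at h1
  have h2 := abs_step_limit_le hr h hf h0 (k * (1 / 2) ^ j)
  have h3 : C / (1 - r) * r ^ j ≤ C / (1 - r) :=
    mul_le_of_le_one_right (div_nonneg hC (by linarith)) (pow_le_one₀ hr0 hr.le)
  rw [abs_le] at *
  constructor <;> linarith [h1.1, h1.2, h2.1, h2.2]

theorem exists_holder_step_limit {α : ℝ} (hα : 0 < α)
    (h : ∀ j K, |x (j + 1) K - x j (K / 2)| ≤ C * ((1 / 2 : ℝ) ^ α) ^ j)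
    (hΔ : ∀ j k, |fwdDiff 1 (x j) k| ≤ C * ((1 / 2 : ℝ) ^ α) ^ j)
    (hf : ∀ t, Tendsto (fun j : ℕ => x j ⌊(2 : ℝ) ^ j * t⌋) atTop (𝓝 (f t)))
    (h0 : ∀ k, |x 0 k| ≤ M) : ∃ B, 0 ≤ B ∧ ∀ t u, |f t - f u| ≤ B * |t - u| ^ α := by
  obtain ⟨r, hrdef⟩ : ∃ r, r = (1 / 2 : ℝ) ^ α := ⟨_, rfl⟩
  rw [← hrdef] at h hΔ
  have hr0 : 0 < r := hrdef ▸ by positivity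
  have hr : r < 1 := hrdef ▸ Real.rpow_lt_one (by norm_num) (by norm_num) hα
  have hC : 0 ≤ C := by simpa using (abs_nonneg _).trans (h 0 0)
  have hM : 0 ≤ M := (abs_nonneg _).trans (h0 0)
  have hr1 : 0 < 1 - r := by linarith
  have hC' : 0 ≤ C / (1 - r) := by positivity
  set B₁ := 2 * (M + C / (1 - r)) with hB₁
  set B₂ := 2 * (C / (1 - r)) + C with hB₂
  refine ⟨B₁ + B₂ * r⁻¹, by positivity, ?_⟩
  have main : ∀ t u, u < t → |f t - f u| ≤ (B₁ + B₂ * r⁻¹) * (t - u) ^ α := by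
    intro t u hut
    have hpos : 0 < t - u := sub_pos.2 hut
    rcases le_or_gt (t - u) 1 with hle | hgt
    · obtain ⟨j, hj1, hj2⟩ := exists_nat_pow_near_of_lt_one hpos hle
        (by norm_num : (0 : ℝ) < 1 / 2) (by norm_num)
      have e : (2 : ℝ) ^ j * (1 / 2) ^ j = 1 := by rw [← mul_pow]; norm_num
      have hd : (2 : ℝ) ^ j * t ≤ 2 ^ j * u + 1 := by
        have := mul_le_mul_of_nonneg_left hj2 (by positivity : (0 : ℝ) ≤ 2 ^ j)
        linarith
      have hd' : (2 : ℝ) ^ j * u ≤ 2 ^ j * t := by gcongr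
      have hfl1 := Int.floor_le_floor hd'
      have hfl2 := Int.floor_le_floor hd
      rw [Int.floor_add_one] at hfl2
      have hstep : |x j ⌊(2 : ℝ) ^ j * t⌋ - x j ⌊(2 : ℝ) ^ j * u⌋| ≤ C * r ^ j := by
        rcases (by omega : ⌊(2 : ℝ) ^ j * t⌋ = ⌊(2 : ℝ) ^ j * u⌋ ∨
          ⌊(2 : ℝ) ^ j * t⌋ = ⌊(2 : ℝ) ^ j * u⌋ + 1) with e | e
        · rw [e, sub_self, abs_zero]; positivity
        · rw [e]; exact hΔ j _
      have h1 := abs_step_sub_le hr h hf j t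
      have h2 := abs_step_sub_le hr h hf j u
      have h3 : |f t - f u| ≤ B₂ * r ^ j := by
        rw [hB₂]
        rw [abs_le] at *
        constructor <;> linarith [h1.1, h1.2, h2.1, h2.2, hstep.1, hstep.2]
      have h4 : r ^ (j + 1) ≤ (t - u) ^ α := by
        rw [hrdef, Real.rpow_pow_comm (by norm_num)]
        exact Real.rpow_le_rpow (by positivity) hj1.le hα.le
      calc |f t - f u| ≤ B₂ * r ^ j := h3
        _ = B₂ * r⁻¹ * r ^ (j + 1) := by rw [pow_succ]; field_simp
        _ ≤ B₂ * r⁻¹ * (t - u) ^ α := by gcongr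
        _ ≤ (B₁ + B₂ * r⁻¹) * (t - u) ^ α := by
            gcongr
            exact le_add_of_nonneg_left (by positivity)
    · have h1 := abs_step_limit_le hr h hf h0 t
      have h2 := abs_step_limit_le hr h hf h0 u
      calc |f t - f u| ≤ |f t| + |f u| := abs_sub _ _
        _ ≤ B₁ := by rw [hB₁]; linarith
        _ ≤ B₁ + B₂ * r⁻¹ := le_add_of_nonneg_right (by positivity)
        _ ≤ _ := le_mul_of_one_le_right (by positivity) (Real.one_le_rpow hgt.le hα.le)
  intro t u
  rcases lt_trichotomy t u with hlt | rfl | hlt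
  · rw [abs_sub_comm, abs_sub_comm t u, abs_of_pos (sub_pos.2 hlt)]
    exact main u t hlt
  · simp [Real.zero_rpow hα.ne']
  · rw [abs_of_pos (sub_pos.2 hlt)]
    exact main t u hlt

theorem abs_sub_sub_mul_le_of_fwdDiff {y : ℤ → ℝ} {m n : ℤ} (hmn : m ≤ n) {c ε : ℝ}
    (h : ∀ k, m ≤ k → k < n → |fwdDiff 1 y k - c| ≤ ε) :
    |y n - y m - (n - m) * c| ≤ (n - m) * ε := by
  induction n, hmn using Int.leInduction with
  | base => simp
  | succ n hmn ih =>
    have h1 := ih fun k hk hk' => h k hk (by omega)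
    have h2 := h n hmn (by omega)
    rw [fwdDiff] at h2
    push_cast
    rw [abs_le] at *
    constructor <;> linarith [h1.1, h1.2, h2.1, h2.2]

theorem abs_sub_sub_mul_le_of_step {F : ℝ → ℝ} {ε : ℕ → ℝ}
    (hF : ∀ t, Tendsto (fun j : ℕ => x j ⌊(2 : ℝ) ^ j * t⌋) atTop (𝓝 (F t)))
    (hf : ∀ j t, |2 ^ j * fwdDiff 1 (x j) ⌊(2 : ℝ) ^ j * t⌋ - f t| ≤ ε j)
    (hε : Tendsto ε atTop (𝓝 0)) {u t c η : ℝ} (hut : u ≤ t)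
    (hc : ∀ w ∈ Set.Icc u t, |f w - c| ≤ η) : |F t - F u - (t - u) * c| ≤ (t - u) * η := by
  have ht := tendsto_floor_div_two_pow t
  have hu := tendsto_floor_div_two_pow u
  have hlim := (ht.sub hu).mul (hε.const_add η)
  rw [add_zero] at hlim
  refine le_of_tendsto_of_tendsto
    (((hF t).sub (hF u)).sub ((ht.sub hu).mul_const c)).abs
    hlim (Eventually.of_forall fun j => ?_)
  have e : (2 : ℝ) ^ j * (1 / 2) ^ j = 1 := by rw [← mul_pow]; norm_num
  have hp : (0 : ℝ) < (1 / 2) ^ j := by positivity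
  have hfl : ⌊(2 : ℝ) ^ j * u⌋ ≤ ⌊(2 : ℝ) ^ j * t⌋ := Int.floor_le_floor (by gcongr)
  have key : ∀ k, ⌊(2 : ℝ) ^ j * u⌋ ≤ k → k < ⌊(2 : ℝ) ^ j * t⌋ →
      |fwdDiff 1 (x j) k - (1 / 2) ^ j * c| ≤ (1 / 2) ^ j * (η + ε j) := by
    intro k hk hk'
    obtain ⟨w, hw, hwk⟩ : ∃ w ∈ Set.Icc u t, ⌊(2 : ℝ) ^ j * w⌋ = k := by
      rcases hk.eq_or_lt with rfl | hk
      · exact ⟨u, ⟨le_rfl, hut⟩, rfl⟩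
      · refine ⟨k * (1 / 2) ^ j, ⟨?_, ?_⟩, ?_⟩
        · have h1 := mul_le_mul_of_nonneg_right (Int.floor_lt.1 hk).le hp.le
          linear_combination h1 - u * e
        · have h1 := mul_le_mul_of_nonneg_right (Int.le_floor.1 hk'.le) hp.le
          linear_combination h1 + t * e
        · rw [mul_left_comm, e, mul_one, Int.floor_intCast]
    have h1 := hf j w
    have h2 := hc w hw
    rw [hwk] at h1
    have h3 : fwdDiff 1 (x j) k - (1 / 2) ^ j * c =
        (1 / 2) ^ j * ((2 ^ j * fwdDiff 1 (x j) k - f w) + (f w - c)) := by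
      linear_combination (-fwdDiff 1 (x j) k) * e
    rw [h3, abs_mul, abs_of_pos hp]
    gcongr
    refine (abs_add_le _ _).trans ?_
    linarith
  have := abs_sub_sub_mul_le_of_fwdDiff hfl key
  refine le_of_eq_of_le ?_ (this.trans_eq ?_)
  · exact congrArg abs (by ring)
  · ring

theorem hasDerivAt_of_step {F : ℝ → ℝ} {ε : ℕ → ℝ}
    (hF : ∀ t, Tendsto (fun j : ℕ => x j ⌊(2 : ℝ) ^ j * t⌋) atTop (𝓝 (F t)))
    (hf : ∀ j t, |2 ^ j * fwdDiff 1 (x j) ⌊(2 : ℝ) ^ j * t⌋ - f t| ≤ ε j)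
    (hε : Tendsto ε atTop (𝓝 0)) (hfc : Continuous f) (u : ℝ) : HasDerivAt F (f u) u := by
  rw [hasDerivAt_iff_isLittleO, Asymptotics.isLittleO_iff]
  intro η hη
  obtain ⟨ρ, hρ, hclose⟩ := Metric.continuous_iff.1 hfc u η hη
  filter_upwards [Metric.ball_mem_nhds u hρ] with t ht
  rw [Metric.mem_ball, Real.dist_eq, abs_lt] at ht
  simp only [smul_eq_mul, Real.norm_eq_abs]
  rcases le_total u t with hut | hut
  · rw [abs_of_nonneg (sub_nonneg.2 hut), mul_comm η]
    refine abs_sub_sub_mul_le_of_step hF hf hε hut fun w hw => (hclose w ?_).le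
    rw [Real.dist_eq, abs_lt]
    constructor <;> linarith [hw.1, hw.2]
  · rw [abs_of_nonpos (sub_nonpos.2 hut), mul_comm η, ← abs_neg]
    have := abs_sub_sub_mul_le_of_step hF hf hε hut (c := f u) (η := η) fun w hw => (hclose w (by
      rw [Real.dist_eq, abs_lt]
      constructor <;> linarith [hw.1, hw.2])).le
    convert this using 2 <;> ring

end StepLimit

/-- One step of the normal transform is subdivision of the parameters, up to a cubic error. -/
theorem abs_sub_S_le_of_normal_step {p : ℕ} {v : ℝ → ℝ × ℝ} {B ρ : ℝ} (hB : 0 ≤ B)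
    (hv : ∀ t ξ, |dot (v t) (deriv v ξ) - dot (v ξ) (deriv v ξ) - (t - ξ)| ≤ B * |t - ξ| ^ 3)
    {x : ℤ → ℝ} {K : ℤ} {y d ξ : ℝ}
    (h : v y = S p (fun k => v (x k)) K + d • perp (deriv v ξ))
    (hx : ∀ k, K / 2 ≤ k → k ≤ K / 2 + p → |x k - ξ| ≤ ρ) (hy : |y - ξ| ≤ ρ) :
    |y - S p x K| ≤ 2 * B * ρ ^ 3 := by
  set E : ℝ → ℝ := fun t => dot (v t) (deriv v ξ) - dot (v ξ) (deriv v ξ) - (t - ξ) with hE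
  have hEle : ∀ t, |t - ξ| ≤ ρ → |E t| ≤ B * ρ ^ 3 := fun t ht =>
    (hv t ξ).trans (by gcongr)
  have h1 : |S p (fun k => E (x k)) K| ≤ B * ρ ^ 3 :=
    abs_S_le_of_local fun k hk hk' => hEle _ (hx k hk hk')
  have h2 := hEle y hy
  have h3 : dot (v y) (deriv v ξ) = S p (fun k => dot (v (x k)) (deriv v ξ)) K := by
    rw [← dot_S, h]
    simp only [dot, perp, Prod.fst_add, Prod.snd_add, Prod.smul_fst, Prod.smul_snd, smul_eq_mul]
    ring
  have h4 : S p (fun k => dot (v (x k)) (deriv v ξ)) K =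
      S p (fun k => E (x k)) K + (S p x K + (dot (v ξ) (deriv v ξ) - ξ)) := by
    conv_rhs => rw [← S_const (p := p) (dot (v ξ) (deriv v ξ) - ξ) K, ← S_add, ← S_add]
    congr 1
    funext k
    simp only [hE]
    ring
  have h5 : y - S p x K = S p (fun k => E (x k)) K - E y := by
    simp only [hE] at h4 ⊢
    linarith
  rw [h5]
  rw [abs_le] at *
  constructor <;> linarith [h1.1, h1.2, h2.1, h2.2]

theorem plin_eq_of_mem_cell {j : ℕ} {x : ℤ → ℝ} {t : ℝ} {k : ℤ} (h1 : k ≤ (2 : ℝ) ^ j * t)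
    (h2 : (2 : ℝ) ^ j * t ≤ k + 1) :
    plin j x t = x k + ((2 : ℝ) ^ j * t - k) * (x (k + 1) - x k) := by
  rcases h2.eq_or_lt with h2 | h2
  · have : ⌊(2 : ℝ) ^ j * t⌋ = k + 1 := by rw [h2]; simp
    simp only [plin, this]
    rw [h2]
    push_cast
    ring
  · have : ⌊(2 : ℝ) ^ j * t⌋ = k := Int.floor_eq_iff.2 ⟨h1, h2⟩
    simp only [plin, this]

theorem plin_node (j : ℕ) (x : ℤ → ℝ) (k : ℤ) : plin j x (k * (1 / 2) ^ j) = x k := by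
  have e : (2 : ℝ) ^ j * (k * (1 / 2) ^ j) = k := by
    rw [mul_left_comm, ← mul_pow]; norm_num
  rw [plin_eq_of_mem_cell (k := k) (by rw [e]) (by rw [e]; linarith), e]
  ring

open Filter in
theorem exists_forall_mesh_le {L : ℝ} {N₀ : ℕ} {s : ℕ → ℤ → ℝ} (hN₀ : 1 ≤ N₀)
    (hsper : ∀ (j : ℕ) (i : ℤ), s j (i + N₀ * 2 ^ j) = s j i + L) {slim : ℝ → ℝ}
    (hconv : TendstoUniformlyOn (fun j => plin j (s j)) slim atTop (Set.Icc 0 (N₀ : ℝ)))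
    (hmesh : ∀ j k, s j (k + 1) - s j k ≤ L) {ε : ℝ} (hε : 0 < ε) :
    ∃ J, ∀ j ≥ J, ∀ k, s j (k + 1) - s j k ≤ ε := by
  obtain ⟨J, hJ⟩ := eventually_atTop.1
    (Metric.tendstoUniformlyOn_iff.1 hconv (ε / 5) (by positivity))
  have hpow : Tendsto (fun n : ℕ => (1 / 2 : ℝ) ^ n * L) atTop (nhds (0 * L)) :=
    (tendsto_pow_atTop_nhds_zero_of_lt_one (by norm_num) (by norm_num)).mul_const L
  rw [zero_mul] at hpow
  obtain ⟨n₀, hn₀⟩ := eventually_atTop.1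
    (hpow.eventually_lt_const (by positivity : (0 : ℝ) < ε / 5))
  refine ⟨J + n₀, fun j hj k => ?_⟩
  obtain ⟨n, rfl⟩ := Nat.exists_eq_add_of_le ((Nat.le_add_right J n₀).trans hj)
  have hn : n₀ ≤ n := by omega
  set N : ℤ := N₀ * 2 ^ (J + n) with hN
  have hNpos : 0 < N := by positivity
  have hperiodic : Function.Periodic (fun k => s (J + n) (k + 1) - s (J + n) k) N := by
    intro k
    have h1 := hsper (J + n) (k + 1)
    have h2 := hsper (J + n) k
    simp only [hN]
    rw [show k + N₀ * 2 ^ (J + n) + 1 = k + 1 + N₀ * 2 ^ (J + n) by ring, h1, h2]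
    ring
  have hmod := hperiodic.sub_int_mul_eq (x := k) (k / N)
  rw [Int.cast_id, mul_comm, ← Int.emod_def] at hmod
  rw [← hmod]
  have hi0 : 0 ≤ k % N := Int.emod_nonneg _ hNpos.ne'
  have hi1 : k % N + 1 ≤ N := Int.emod_lt_of_pos _ hNpos
  generalize k % N = i at hi0 hi1
  have hmem : ∀ m : ℤ, 0 ≤ m → m ≤ N → (m : ℝ) * (1 / 2) ^ (J + n) ∈ Set.Icc 0 (N₀ : ℝ) := by
    intro m hm hm'
    have hmc : (m : ℝ) ≤ N₀ * 2 ^ (J + n) := by exact_mod_cast hm'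
    have hm0 : (0 : ℝ) ≤ m := by exact_mod_cast hm
    refine ⟨by positivity, ?_⟩
    rw [one_div, inv_pow, ← div_eq_mul_inv, div_le_iff₀ (by positivity)]
    exact hmc
  have hclose : ∀ m : ℤ, 0 ≤ m → m ≤ N →
      |s (J + n) m - plin J (s J) (m * (1 / 2) ^ (J + n))| ≤ 2 * (ε / 5) := by
    intro m hm hm'
    have h1 := hJ (J + n) (by omega) _ (hmem m hm hm')
    have h2 := hJ J le_rfl _ (hmem m hm hm')
    rw [plin_node, Real.dist_eq] at h1
    rw [Real.dist_eq] at h2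
    rw [abs_lt] at h1 h2
    rw [abs_le]
    constructor <;> linarith [h1.1, h1.2, h2.1, h2.2]
  have hscale : ∀ m : ℝ, (2 : ℝ) ^ J * (m * (1 / 2) ^ (J + n)) = m * (1 / 2) ^ n := by
    intro m
    have e : (2 : ℝ) ^ J * (1 / 2) ^ J = 1 := by rw [← mul_pow]; norm_num
    rw [pow_add]
    linear_combination m * (1 / 2) ^ n * e
  have hn2 : (2 : ℝ) ^ n * (1 / 2) ^ n = 1 := by rw [← mul_pow]; norm_num
  have hpos : (0 : ℝ) < (1 / 2) ^ n := by positivity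
  obtain ⟨c, hc⟩ : ∃ c, c = ⌊(i : ℝ) * (1 / 2) ^ n⌋ := ⟨_, rfl⟩
  have hc1 : (c : ℝ) ≤ i * (1 / 2) ^ n := hc ▸ Int.floor_le _
  have hc2 : ((i + 1 : ℤ) : ℝ) * (1 / 2) ^ n ≤ c + 1 := by
    have h1 : (i : ℝ) * (1 / 2) ^ n < c + 1 := hc ▸ Int.lt_floor_add_one _
    have h2 : (i : ℝ) < (c + 1) * 2 ^ n := by
      have := mul_lt_mul_of_pos_right h1 (by positivity : (0 : ℝ) < 2 ^ n)
      linear_combination this - i * hn2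
    have h3 : i < (c + 1) * 2 ^ n := by exact_mod_cast h2
    have h4 : ((i + 1 : ℤ) : ℝ) ≤ (c + 1) * 2 ^ n := by exact_mod_cast h3
    have := mul_le_mul_of_nonneg_right h4 hpos.le
    linear_combination this + (c + 1) * hn2
  have hlt : (i : ℝ) * (1 / 2) ^ n ≤ ((i + 1 : ℤ) : ℝ) * (1 / 2) ^ n := by
    push_cast; gcongr; linarith
  have p1 : plin J (s J) (i * (1 / 2) ^ (J + n)) = _ :=
    plin_eq_of_mem_cell (k := c) (by rw [hscale]; exact hc1) (by rw [hscale]; linarith)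
  have p2 : plin J (s J) ((i + 1 : ℤ) * (1 / 2) ^ (J + n)) = _ :=
    plin_eq_of_mem_cell (k := c) (by rw [hscale]; linarith) (by rw [hscale]; exact hc2)
  have h1 := hclose i hi0 (by omega)
  have h2 := hclose (i + 1) (by omega) hi1
  rw [p1, hscale] at h1
  rw [p2, hscale] at h2
  have h3 := mul_le_mul_of_nonneg_left (hmesh J c) hpos.le
  have h4 := hn₀ n hn
  rw [abs_le] at h1 h2
  push_cast at h2
  linarith [h1.1, h1.2, h2.1, h2.2]

theorem abs_scaled_fwdDiff_sub_S_le {p j : ℕ} {x y : ℤ → ℝ} {ε : ℝ}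
    (h : ∀ i, |y i - S (p + 1) x i| ≤ ε) (i : ℤ) :
    |2 ^ (j + 1) * fwdDiff 1 y i - S p (fun k => 2 ^ j * fwdDiff 1 x k) i| ≤
      2 ^ (j + 2) * ε := by
  have h1 := abs_fwdDiff_sub_S_le h i
  have h2 : 2 ^ (j + 1) * fwdDiff 1 y i - S p (fun k => 2 ^ j * fwdDiff 1 x k) i =
      2 ^ (j + 1) * (fwdDiff 1 y i - 2⁻¹ * S p (fwdDiff 1 x) i) := by
    rw [S_const_mul]; ring
  rw [h2, abs_mul, abs_of_pos (by positivity)]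
  calc _ ≤ 2 ^ (j + 1) * (2 * ε) := by gcongr
    _ = _ := by ring

theorem abs_fwdDiff_le {x : ℤ → ℝ} {M : ℝ} (h : ∀ k, |x k| ≤ M) (k : ℤ) :
    |fwdDiff 1 x k| ≤ 2 * M := by
  have h1 := h (k + 1)
  have h2 := h k
  rw [fwdDiff]
  rw [abs_le] at *
  constructor <;> linarith [h1.1, h1.2, h2.1, h2.2]

theorem exists_le_geometric_of_half_recursion {w : ℕ → ℤ → ℝ} {M E r : ℝ} (hE : 0 ≤ E)
    (hr : 1 / 2 < r) (h0 : ∀ k, |w 0 k| ≤ M) {q : ℕ}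
    (h : ∀ j k, |w (j + 1) k - 2⁻¹ * S q (w j) k| ≤ E * (1 / 2) ^ j) :
    ∃ C, 0 ≤ C ∧ ∀ j k, |w j k| ≤ C * r ^ j := by
  have hM : 0 ≤ M := (abs_nonneg _).trans (h0 0)
  have hr' : 0 < r - 1 / 2 := by linarith
  have hC : 0 ≤ M + E / (r - 1 / 2) := by positivity
  refine ⟨M + E / (r - 1 / 2), hC, fun j => ?_⟩
  induction j with
  | zero =>
    intro k
    rw [pow_zero, mul_one]
    exact (h0 k).trans (le_add_of_nonneg_right (by positivity))
  | succ j ih =>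
    intro k
    have h1 := h j k
    have h2 := abs_S_le (p := q) ih k
    have h3 : E * (1 / 2) ^ j ≤ E * r ^ j := by gcongr
    have h4 : E ≤ (M + E / (r - 1 / 2)) * (r - 1 / 2) := by
      rw [add_mul, div_mul_cancel₀ _ hr'.ne']
      exact le_add_of_nonneg_left (by positivity)
    have h5 := mul_le_mul_of_nonneg_right h4 (by positivity : 0 ≤ r ^ j)
    rw [pow_succ]
    generalize (M + E / (r - 1 / 2)) = C at *
    rw [abs_le] at *
    constructor <;> nlinarith [h1.1, h1.2, h2.1, h2.2]

open Filter Topology in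
/-- Perturbing `S_{q+3}` by errors of size `O(8^{-j})` yields `C^{2,1-}` limits. -/
theorem contDiff_two_and_holder_of_perturbed_S {q : ℕ} {s : ℕ → ℤ → ℝ} {E M : ℝ} {F : ℝ → ℝ}
    (hE : ∀ j K, |s (j + 1) K - S (q + 3) (s j) K| ≤ E * (1 / 8) ^ j)
    (hM : ∀ k, |fwdDiff 1 (s 0) k| ≤ M)
    (hF : ∀ t, Tendsto (fun j : ℕ => s j ⌊(2 : ℝ) ^ j * t⌋) atTop (𝓝 (F t))) :
    ContDiff ℝ 2 F ∧ ∀ α : ℝ, 0 < α → α < 1 → ∃ B, ∀ t u,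
      |deriv (deriv F) t - deriv (deriv F) u| ≤ B * |t - u| ^ α := by
  have hE0 : 0 ≤ E := by simpa using (abs_nonneg _).trans (hE 0 0)
  set y : ℕ → ℤ → ℝ := fun j k => 2 ^ j * fwdDiff 1 (s j) k with hy
  set z : ℕ → ℤ → ℝ := fun j k => 2 ^ j * fwdDiff 1 (y j) k with hz
  have ystep : ∀ j K, |y (j + 1) K - S (q + 2) (y j) K| ≤ 4 * E * (1 / 4) ^ j := by
    intro j K
    refine (abs_scaled_fwdDiff_sub_S_le (j := j) (hE j) K).trans_eq ?_
    rw [show (1 / 4 : ℝ) = 2 * (1 / 8) by norm_num, mul_pow]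
    ring
  have zstep : ∀ j K, |z (j + 1) K - S (q + 1) (z j) K| ≤ 16 * E * (1 / 2) ^ j := by
    intro j K
    refine (abs_scaled_fwdDiff_sub_S_le (j := j) (ystep j) K).trans_eq ?_
    rw [show (1 / 2 : ℝ) = 2 * (1 / 4) by norm_num, mul_pow]
    ring
  have wstep : ∀ j K, |fwdDiff 1 (z (j + 1)) K - 2⁻¹ * S q (fwdDiff 1 (z j)) K| ≤
      32 * E * (1 / 2) ^ j := fun j K =>
    (abs_fwdDiff_sub_S_le (zstep j) K).trans_eq (by ring)
  have y0 : ∀ k, |y 0 k| ≤ M := by simpa [hy] using hM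
  have z0 : ∀ k, |z 0 k| ≤ 2 * M := by simpa [hz] using abs_fwdDiff_le y0
  have zrate : ∀ r : ℝ, 1 / 2 < r → ∃ C, (∀ j k, |fwdDiff 1 (z j) k| ≤ C * r ^ j) ∧
      ∀ j K, |z (j + 1) K - z j (K / 2)| ≤ C * r ^ j := by
    intro r hr
    have hr0 : 0 < r := by linarith
    obtain ⟨C, hC, h⟩ := exists_le_geometric_of_half_recursion (w := fun j => fwdDiff 1 (z j))
      (by positivity) hr (abs_fwdDiff_le z0) wstep
    refine ⟨16 * E + (q + 2) * C, fun j k => (h j k).trans ?_, fun j K => ?_⟩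
    · gcongr
      nlinarith [mul_nonneg (Nat.cast_nonneg (α := ℝ) q) hC]
    · have h1 := zstep j K
      have h2 := abs_S_sub_le (p := q + 1) (h j) K
      have h3 : 16 * E * (1 / 2) ^ j ≤ 16 * E * r ^ j := by gcongr
      have h4 : 0 ≤ C * r ^ j := by positivity
      push_cast at h2
      rw [abs_le] at *
      constructor <;> linarith [h1.1, h1.2, h2.1, h2.2]
  have hhalf : ∀ α : ℝ, α < 1 → (1 / 2 : ℝ) < (1 / 2) ^ α := by
    intro α hα
    simpa using Real.rpow_lt_rpow_of_exponent_gt (by norm_num : (0 : ℝ) < 1 / 2) (by norm_num) hα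
  obtain ⟨C, -, zdiff⟩ := zrate (3 / 4) (by norm_num)
  obtain ⟨g, hg⟩ := exists_tendsto_step (by norm_num) zdiff
  have gholder : ∀ α : ℝ, 0 < α → α < 1 → ∃ B, 0 ≤ B ∧ ∀ t u, |g t - g u| ≤ B * |t - u| ^ α := by
    intro α hα hα'
    obtain ⟨C', h1, h2⟩ := zrate _ (hhalf α hα')
    exact exists_holder_step_limit hα h2 h1 hg z0
  have gcont : Continuous g := by
    obtain ⟨B, -, h⟩ := gholder (1 / 2) (by norm_num) (by norm_num)
    refine continuous_iff_continuousAt.2 fun u => tendsto_iff_dist_tendsto_zero.2 ?_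
    have hlim : Tendsto (fun t => B * |t - u| ^ (1 / 2 : ℝ)) (𝓝 u)
        (𝓝 (B * |u - u| ^ (1 / 2 : ℝ))) :=
      Continuous.tendsto (by fun_prop (disch := norm_num)) u
    rw [sub_self, abs_zero, Real.zero_rpow (by norm_num), mul_zero] at hlim
    exact squeeze_zero (fun _ => dist_nonneg) (fun t => h t u) hlim
  obtain ⟨D, hD⟩ := exists_step_bound (by norm_num) (by norm_num) zdiff z0
  have hD0 : 0 ≤ D := (abs_nonneg _).trans (hD 0 0)
  have yΔ : ∀ j k, |fwdDiff 1 (y j) k| ≤ D * (1 / 2) ^ j := by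
    intro j k
    have e : (2 : ℝ) ^ j * (1 / 2) ^ j = 1 := by rw [← mul_pow]; norm_num
    have h1 := hD j k
    simp only [hz] at h1
    rw [abs_mul, abs_of_pos (by positivity)] at h1
    have := mul_le_mul_of_nonneg_right h1 (by positivity : (0 : ℝ) ≤ (1 / 2) ^ j)
    linear_combination this - |fwdDiff 1 (y j) k| * e
  have ydiff : ∀ j K, |y (j + 1) K - y j (K / 2)| ≤ (4 * E + (q + 2) * D) * (1 / 2) ^ j := by
    intro j K
    have h1 := ystep j K
    have h2 := abs_S_sub_le (p := q + 2) (yΔ j) K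
    have h3 : 4 * E * (1 / 4) ^ j ≤ 4 * E * (1 / 2) ^ j := by gcongr; norm_num
    push_cast at h2
    rw [abs_le] at *
    constructor <;> linarith [h1.1, h1.2, h2.1, h2.2]
  obtain ⟨f, hf⟩ := exists_tendsto_step (by norm_num) ydiff
  have null : ∀ (c r : ℝ), 0 ≤ r → r < 1 → Tendsto (fun j : ℕ => c * r ^ j) atTop (𝓝 0) :=
    fun c r h h' => by simpa using (tendsto_pow_atTop_nhds_zero_of_lt_one h h').const_mul c
  have fderiv : ∀ u, HasDerivAt f (g u) u :=
    hasDerivAt_of_step hf (abs_step_sub_le (by norm_num) zdiff hg)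
      (null _ _ (by norm_num) (by norm_num)) gcont
  have Fderiv : ∀ u, HasDerivAt F (f u) u :=
    hasDerivAt_of_step hF (abs_step_sub_le (by norm_num) ydiff hf)
      (null _ _ (by norm_num) (by norm_num))
      (continuous_iff_continuousAt.2 fun u => (fderiv u).continuousAt)
  have dF : deriv F = f := funext fun u => (Fderiv u).deriv
  have df : deriv f = g := funext fun u => (fderiv u).deriv
  refine ⟨?_, fun α hα hα' => ?_⟩
  · rw [show (2 : WithTop ℕ∞) = 1 + 1 from one_add_one_eq_two.symm, contDiff_succ_iff_deriv]
    refine ⟨fun u => (Fderiv u).differentiableAt, by simp, ?_⟩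
    rw [dF, contDiff_one_iff_deriv, df]
    exact ⟨fun u => (fderiv u).differentiableAt, gcont⟩
  · obtain ⟨B, -, h⟩ := gholder α hα hα'
    rw [dF, df]
    exact ⟨B, h⟩

/-- Theorem 3.1: for `p ≥ 3` and a simple closed `C³` arc-length curve, a well-posed and
convergent `S_p` normal multiscale transform has a `C^{2,1−}` normal re-parametrization:
the limit `s(t)` is twice continuously differentiable and `s''` is `α`-Hölder on every
compact interval for every `α < 1`. -/
theorem Sp_normal_MT_smoothness (p : ℕ) (hp : 3 ≤ p) (C₁ : ℝ) (hC₁ : 0 < C₁)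
    (L : ℝ) (hL : 0 < L) (v : ℝ → ℝ × ℝ) (hper : ∀ t, v (t + L) = v t)
    (hreg : ContDiff ℝ 3 v) (hunit : ∀ t, dot (deriv v t) (deriv v t) = 1)
    (hsimple : Set.InjOn v (Set.Ico 0 L))
    (N₀ : ℕ) (hN₀ : 1 ≤ N₀)
    (s : ℕ → ℤ → ℝ) (hmono : ∀ j, StrictMono (s j))
    (hsper : ∀ (j : ℕ) (i : ℤ), s j (i + N₀ * 2 ^ j) = s j i + L)
    (d ξ : ℕ → ℤ → ℝ)
    (hdata : ∀ j : ℕ, 1 ≤ j → ∀ i K : ℤ, 2 * i ≤ K → K ≤ 2 * i + p + 2 →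
      v (s j K) = S p (fun k => v (s (j - 1) k)) K + d j K • perp (deriv v (ξ j K)) ∧
      (∀ k : ℤ, i ≤ k → k ≤ i + p + 1 → |ξ j K - s (j - 1) k| ≤ C₁ * hmax p (s (j - 1)) i) ∧
      |s j K - ξ j K| ≤ C₁ * hmax p (s (j - 1)) i)
    (slim : ℝ → ℝ)
    (hconv : ∀ A : Set ℝ, IsCompact A →
      TendstoUniformlyOn (fun j => plin j (s j)) slim Filter.atTop A) :
    ContDiff ℝ 2 slim ∧
    ∀ α : ℝ, 0 < α → α < 1 → ∀ a b : ℝ, ∃ C : ℝ,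
      ∀ t ∈ Set.Icc a b, ∀ u ∈ Set.Icc a b,
        |deriv (deriv slim) t - deriv (deriv slim) u| ≤ C * |t - u| ^ α := by
  obtain ⟨q, rfl⟩ := Nat.exists_eq_add_of_le' hp
  obtain ⟨B, hB, hv⟩ := exists_tangential_taylor_bound hL hper (hreg.of_le (by norm_num)) hunit
  have hmesh : ∀ j k, s j (k + 1) - s j k ≤ L := by
    intro j k
    have h1 : s j (k + 1) ≤ s j (k + N₀ * 2 ^ j) := (hmono j).monotone (by
      have : (0 : ℤ) < N₀ * 2 ^ j := by positivity
      omega)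
    linarith [hsper j k]
  set δ : ℕ → ℝ := fun j => ⨆ k, s j (k + 1) - s j k with hδ
  have hle : ∀ j k, s j (k + 1) - s j k ≤ δ j := fun j k =>
    le_ciSup (f := fun k => s j (k + 1) - s j k) ⟨L, by rintro _ ⟨k, rfl⟩; exact hmesh j k⟩ k
  have hpos : ∀ j k, 0 < s j (k + 1) - s j k := fun j k =>
    sub_pos.2 (hmono j (lt_add_one k))
  have hδ0 : ∀ j, 0 ≤ δ j := fun j => (hpos j 0).le.trans (hle j 0)
  have hcons : ∀ j K, |s (j + 1) K - S (q + 3) (s j) K| ≤ 2 * B * C₁ ^ 3 * δ j ^ 3 := by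
    intro j K
    obtain ⟨h1, h2, h3⟩ := hdata (j + 1) (by omega) (K / 2) K (by omega) (by omega)
    rw [Nat.add_sub_cancel] at h1 h2 h3
    have hh : C₁ * hmax (q + 3) (s j) (K / 2) ≤ C₁ * δ j :=
      mul_le_mul_of_nonneg_left (Finset.sup'_le _ _ fun l _ => hle j l) hC₁.le
    refine (abs_sub_S_le_of_normal_step hB hv h1 (fun k hk hk' => ?_) (h3.trans hh)).trans_eq
      (by ring)
    rw [abs_sub_comm]
    exact (h2 k hk (by omega)).trans hh
  have hrec : ∀ j, δ (j + 1) ≤ δ j / 2 + 4 * B * C₁ ^ 3 * δ j ^ 3 := by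
    refine fun j => ciSup_le fun k => ?_
    have h1 := abs_fwdDiff_sub_S_le (hcons j) k
    have h2 : |S (q + 2) (fwdDiff 1 (s j)) k| ≤ δ j :=
      abs_S_le (fun l => (abs_of_pos (hpos j l)).trans_le (hle j l)) k
    rw [fwdDiff] at h1
    linarith [(abs_le.1 h1).2, (abs_le.1 h2).2]
  have hδlim : Filter.Tendsto δ Filter.atTop (nhds 0) := by
    refine Metric.tendsto_atTop.2 fun ε hε => ?_
    obtain ⟨J, hJ⟩ := exists_forall_mesh_le hN₀ hsper (hconv _ isCompact_Icc) hmesh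
      (half_pos hε)
    refine ⟨J, fun j hj => ?_⟩
    rw [Real.dist_0_eq_abs, abs_of_nonneg (hδ0 j)]
    exact (ciSup_le (hJ j hj)).trans_lt (half_lt_self hε)
  obtain ⟨C, hC⟩ := exists_le_half_pow_of_cubic_recursion (by positivity) hδ0 hrec hδlim
  have hE : ∀ j K, |s (j + 1) K - S (q + 3) (s j) K| ≤
      2 * B * C₁ ^ 3 * C ^ 3 * (1 / 8) ^ j := by
    intro j K
    calc _ ≤ _ := hcons j K
      _ ≤ 2 * B * C₁ ^ 3 * (C * (1 / 2) ^ j) ^ 3 := by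
          gcongr
          · exact hδ0 j
          · exact hC j
      _ = _ := by
          rw [show (1 / 8 : ℝ) = (1 / 2) ^ 3 by norm_num, pow_right_comm]
          ring
  have hF : ∀ t, Filter.Tendsto (fun j : ℕ => s j ⌊(2 : ℝ) ^ j * t⌋) Filter.atTop
      (nhds (slim t)) := by
    intro t
    have h1 : Filter.Tendsto (fun j => plin j (s j) t) Filter.atTop (nhds (slim t)) :=
      (hconv {t} isCompact_singleton).tendsto_at rfl
    have h2 : Filter.Tendsto (fun j => plin j (s j) t - δ j) Filter.atTop
        (nhds (slim t)) := by simpa using h1.sub hδlim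
    refine tendsto_of_tendsto_of_tendsto_of_le_of_le h2 h1 (fun j => ?_) fun j => ?_
    · have h3 := hle j ⌊(2 : ℝ) ^ j * t⌋
      have h4 := mul_le_mul_of_nonneg_right (Int.fract_lt_one ((2 : ℝ) ^ j * t)).le
        (hpos j ⌊(2 : ℝ) ^ j * t⌋).le
      simp only [plin, Int.self_sub_floor]
      linarith
    · have := mul_nonneg (Int.fract_nonneg ((2 : ℝ) ^ j * t)) (hpos j ⌊(2 : ℝ) ^ j * t⌋).le
      simp only [plin, Int.self_sub_floor]
      linarith
  obtain ⟨hsmooth, hholder⟩ := contDiff_two_and_holder_of_perturbed_S hE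
    (fun k => (abs_of_pos (hpos 0 k)).trans_le (hmesh 0 k)) hF
  refine ⟨hsmooth, fun α hα hα' a b => ?_⟩
  obtain ⟨D, hD⟩ := hholder α hα hα'
  exact ⟨D, fun t _ u _ => hD t u⟩
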